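/- arXiv:1911.07212 — 3 statements merged into one kernel-verified Lean document; each statement's English description precedes it below -/
import Mathlib

section
/- The GF(4)-linear span in GF(4)^9 of the five vectors r1=(1,0,0,0,0,ω̄,1,1,1), r3=(0,1,0,0,0,1,ω,ω̄,0), r5=(0,0,1,0,0,0,1,ω,ω̄), r7=(0,0,0,1,0,ω̄,ω̄,0,1), r9=(0,0,0,0,1,1,ω,1,1) is a linear [9,5,4] code over GF(4): it has GF(4)-dimension 5, every nonzero element has Hamming weight at least 4, and some element has Hamming weight exactly 4. -/
open Matrix
open scoped Classical

noncomputable section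

abbrev F4 := GaloisField 2 2
abbrev F2 := ZMod 2

/-- Hamming weight: number of nonzero coordinates. -/
def wt {n : ℕ} {α : Type*} [Zero α] (v : Fin n → α) : ℕ :=
  Nat.card {i : Fin n // v i ≠ 0}

def r1 (ω : F4) : Fin 9 → F4 := ![1, 0, 0, 0, 0, ω + 1, 1, 1, 1]
def r2 (ω : F4) : Fin 9 → F4 := ![ω, 0, 0, 0, 0, 1, ω, ω, ω]
def r3 (ω : F4) : Fin 9 → F4 := ![0, 1, 0, 0, 0, 1, ω, ω + 1, 0]
def r4 (ω : F4) : Fin 9 → F4 := ![0, ω, 0, 0, 0, ω, ω + 1, 1, 0]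
def r5 (ω : F4) : Fin 9 → F4 := ![0, 0, 1, 0, 0, 0, 1, ω, ω + 1]
def r6 (ω : F4) : Fin 9 → F4 := ![0, 0, ω, 0, 0, 0, ω, ω + 1, 1]
def r7 (ω : F4) : Fin 9 → F4 := ![0, 0, 0, 1, 0, ω + 1, ω + 1, 0, 1]
def r8 (ω : F4) : Fin 9 → F4 := ![0, 0, 0, ω, 0, 1, 1, 0, ω]
def r9 (ω : F4) : Fin 9 → F4 := ![0, 0, 0, 0, 1, 1, ω, 1, 1]
def r10 (ω : F4) : Fin 9 → F4 := ![0, 0, 0, 0, ω, ω, ω + 1, ω, ω]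

/-- The GF(4)-linear span of r1, r3, r5, r7, r9 in GF(4)⁹. -/
def D9 (ω : F4) : Submodule F4 (Fin 9 → F4) :=
  Submodule.span F4 (Set.range ![r1 ω, r3 ω, r5 ω, r7 ω, r9 ω])

/-- The element of `GF(4)` with coordinates `p` over `GF(2)` in the basis `1, ω`. -/
def ofCoords (ω : F4) (p : Bool × Bool) : F4 :=
  (bif p.1 then 1 else 0) + (bif p.2 then ω else 0)

/-- Addition in coordinates. -/
def addCoords (p q : Bool × Bool) : Bool × Bool := (p.1 ^^ q.1, p.2 ^^ q.2)

/-- Multiplication by `ω` in coordinates. -/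
def mulOmega (p : Bool × Bool) : Bool × Bool := (p.2, p.1 ^^ p.2)

/-- Multiplication by `ω + 1` in coordinates. -/
def mulOmegaAddOne (p : Bool × Bool) : Bool × Bool := (p.1 ^^ p.2, p.1)

instance : Zero (Bool × Bool) := ⟨(false, false)⟩

/-- The codeword with information symbols `a b c d f`, in coordinates. -/
def codeword (a b c d f : Bool × Bool) : Fin 9 → Bool × Bool :=
  ![a, b, c, d, f,
    addCoords (mulOmegaAddOne (addCoords a d)) (addCoords b f),
    addCoords (addCoords a c) (addCoords (mulOmega (addCoords b f)) (mulOmegaAddOne d)),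
    addCoords (addCoords a f) (addCoords (mulOmegaAddOne b) (mulOmega c)),
    addCoords (addCoords a d) (addCoords (mulOmegaAddOne c) f)]

/-- The weight of a single coordinate. -/
def coordWeight (p : Bool × Bool) : ℕ := (p.1 || p.2).toNat

theorem hammingNorm_eq_sum_coordWeight {n : ℕ} (w : Fin n → Bool × Bool) :
    hammingNorm w = ∑ i, coordWeight (w i) := by
  rw [hammingNorm, Finset.card_filter]
  refine Finset.sum_congr rfl fun i _ => ?_
  rcases w i with ⟨_ | _, _ | _⟩ <;> rfl

theorem four_le_sum_coordWeight : ∀ a₁ a₂ b₁ b₂ c₁ c₂ d₁ d₂ f₁ f₂ : Bool,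
    (a₁ || a₂ || b₁ || b₂ || c₁ || c₂ || d₁ || d₂ || f₁ || f₂) = false ∨
      Nat.ble 4 (coordWeight (a₁, a₂) + coordWeight (b₁, b₂) + coordWeight (c₁, c₂) +
        coordWeight (d₁, d₂) + coordWeight (f₁, f₂) +
        coordWeight (addCoords (mulOmegaAddOne (addCoords (a₁, a₂) (d₁, d₂)))
          (addCoords (b₁, b₂) (f₁, f₂))) +
        coordWeight (addCoords (addCoords (a₁, a₂) (c₁, c₂))
          (addCoords (mulOmega (addCoords (b₁, b₂) (f₁, f₂))) (mulOmegaAddOne (d₁, d₂)))) +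
        coordWeight (addCoords (addCoords (a₁, a₂) (f₁, f₂))
          (addCoords (mulOmegaAddOne (b₁, b₂)) (mulOmega (c₁, c₂)))) +
        coordWeight (addCoords (addCoords (a₁, a₂) (d₁, d₂))
          (addCoords (mulOmegaAddOne (c₁, c₂)) (f₁, f₂)))) = true := by
  decide +kernel

theorem four_le_hammingNorm_codeword (a b c d f : Bool × Bool) :
    (a = 0 ∧ b = 0 ∧ c = 0 ∧ d = 0 ∧ f = 0) ∨
      4 ≤ hammingNorm (codeword a b c d f) := by
  have hsum (n : Fin 9 → ℕ) :
      ∑ i, n i = n 0 + n 1 + n 2 + n 3 + n 4 + n 5 + n 6 + n 7 + n 8 := by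
    rw [Fin.sum_univ_castSucc, Fin.sum_univ_eight]
    rfl
  rw [hammingNorm_eq_sum_coordWeight, hsum]
  refine (four_le_sum_coordWeight a.1 a.2 b.1 b.2 c.1 c.2 d.1 d.2 f.1 f.2).imp (fun h => ?_)
    fun h => by simpa only [codeword, Matrix.cons_val] using Nat.le_of_ble_eq_true h
  simp only [Bool.or_eq_false_iff] at h
  obtain ⟨⟨⟨⟨⟨⟨⟨⟨⟨ha₁, ha₂⟩, hb₁⟩, hb₂⟩, hc₁⟩, hc₂⟩, hd₁⟩, hd₂⟩, hf₁⟩, hf₂⟩ := h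
  exact ⟨Prod.ext ha₁ ha₂, Prod.ext hb₁ hb₂, Prod.ext hc₁ hc₂, Prod.ext hd₁ hd₂,
    Prod.ext hf₁ hf₂⟩

@[simp]
theorem ofCoords_zero (ω : F4) : ofCoords ω 0 = 0 := by
  change (0 : F4) + 0 = 0
  simp

theorem ofCoords_addCoords (ω : F4) (p q : Bool × Bool) :
    ofCoords ω (addCoords p q) = ofCoords ω p + ofCoords ω q := by
  have h2 : (2 : F4) = 0 := CharTwo.two_eq_zero
  rcases p with ⟨_ | _, _ | _⟩ <;> rcases q with ⟨_ | _, _ | _⟩ <;>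
    simp [ofCoords, addCoords] <;> grind

theorem ofCoords_mulOmega {ω : F4} (hω : ω ^ 2 = ω + 1) (p : Bool × Bool) :
    ofCoords ω (mulOmega p) = ω * ofCoords ω p := by
  have h2 : (2 : F4) = 0 := CharTwo.two_eq_zero
  rcases p with ⟨_ | _, _ | _⟩ <;> simp [ofCoords, mulOmega] <;> grind

theorem ofCoords_mulOmegaAddOne {ω : F4} (hω : ω ^ 2 = ω + 1) (p : Bool × Bool) :
    ofCoords ω (mulOmegaAddOne p) = (ω + 1) * ofCoords ω p := by
  have h2 : (2 : F4) = 0 := CharTwo.two_eq_zero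
  rcases p with ⟨_ | _, _ | _⟩ <;> simp [ofCoords, mulOmegaAddOne] <;> grind

theorem eq_of_sq_eq_add_one {ω : F4} (hω : ω ^ 2 = ω + 1) (x : F4) :
    x = 0 ∨ x = 1 ∨ x = ω ∨ x = ω + 1 := by
  have hcard : Nat.card F4 = 4 := by
    simpa using GaloisField.card 2 2 (by norm_num)
  have hx : x ^ 4 = x := by
    have : Fintype F4 := Fintype.ofFinite _
    rw [← hcard, Nat.card_eq_fintype_card, FiniteField.pow_card]
  have h2 : (2 : F4) = 0 := CharTwo.two_eq_zero
  have h : x * ((x - 1) * ((x - ω) * (x - (ω + 1)))) = 0 := by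
    linear_combination hx + (x ^ 2 - x) * hω -
      (ω * x ^ 3 - 2 * ω * x ^ 2 + ω * x + x ^ 3 - x ^ 2) * h2
  simpa [mul_eq_zero, sub_eq_zero] using h

theorem ofCoords_surjective {ω : F4} (hω : ω ^ 2 = ω + 1) :
    Function.Surjective (ofCoords ω) := by
  intro x
  rcases eq_of_sq_eq_add_one hω x with rfl | rfl | rfl | rfl
  · exact ⟨(false, false), by simp [ofCoords]⟩
  · exact ⟨(true, false), by simp [ofCoords]⟩
  · exact ⟨(false, true), by simp [ofCoords]⟩
  · exact ⟨(true, true), by simp [ofCoords, add_comm]⟩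

theorem ofCoords_injective {ω : F4} (hω : ω ^ 2 = ω + 1) :
    Function.Injective (ofCoords ω) := by
  have hcard : Nat.card (Bool × Bool) = Nat.card F4 := by
    simpa using (GaloisField.card 2 2 (by norm_num)).symm
  exact ((Nat.bijective_iff_surjective_and_card _).2 ⟨ofCoords_surjective hω, hcard⟩).1

theorem mem_D9_iff (ω : F4) (v : Fin 9 → F4) :
    v ∈ D9 ω ↔ ∃ g : Fin 5 → F4,
      g 0 • r1 ω + g 1 • r3 ω + g 2 • r5 ω + g 3 • r7 ω + g 4 • r9 ω = v := by
  simp only [D9, Submodule.mem_span_range_iff_exists_fun, Fin.sum_univ_five]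
  rfl

theorem ofCoords_codeword {ω : F4} (hω : ω ^ 2 = ω + 1) (a b c d f : Bool × Bool) :
    ofCoords ω a • r1 ω + ofCoords ω b • r3 ω + ofCoords ω c • r5 ω + ofCoords ω d • r7 ω +
      ofCoords ω f • r9 ω = fun i => ofCoords ω (codeword a b c d f i) := by
  funext i
  fin_cases i <;>
    simp [r1, r3, r5, r7, r9, codeword, ofCoords_addCoords, ofCoords_mulOmega hω,
      ofCoords_mulOmegaAddOne hω] <;> ring

theorem wt_eq_hammingNorm {n : ℕ} {α : Type*} [Zero α] [DecidableEq α] (v : Fin n → α) :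
    wt v = hammingNorm v := by
  rw [wt, Nat.card_eq_fintype_card, Fintype.card_subtype, hammingNorm]

theorem linearIndependent_rows (ω : F4) :
    LinearIndependent F4 ![r1 ω, r3 ω, r5 ω, r7 ω, r9 ω] := by
  rw [Fintype.linearIndependent_iff]
  intro g hg i
  have h (j : Fin 9) := congrFun hg j
  fin_cases i
  · simpa [Fin.sum_univ_five, r1, r3, r5, r7, r9] using h 0
  · simpa [Fin.sum_univ_five, r1, r3, r5, r7, r9] using h 1
  · simpa [Fin.sum_univ_five, r1, r3, r5, r7, r9] using h 2
  · simpa [Fin.sum_univ_five, r1, r3, r5, r7, r9] using h 3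
  · simpa [Fin.sum_univ_five, r1, r3, r5, r7, r9] using h 4

theorem stmt3 (ω : F4) (hω : ω ^ 2 = ω + 1) :
    Module.finrank F4 (D9 ω) = 5 ∧
    (∀ v ∈ D9 ω, v ≠ 0 → 4 ≤ wt v) ∧ (∃ v ∈ D9 ω, wt v = 4) := by
  have wt_ofCoords (w : Fin 9 → Bool × Bool) :
      wt (fun i => ofCoords ω (w i)) = hammingNorm w := by
    rw [wt_eq_hammingNorm]
    exact hammingNorm_comp (fun _ => ofCoords ω) (fun _ => ofCoords_injective hω)
      fun _ => ofCoords_zero ω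
  refine ⟨?_, ?_, ?_⟩
  · exact (finrank_span_eq_card (linearIndependent_rows ω)).trans (Fintype.card_fin 5)
  · intro v hv hne
    obtain ⟨g, rfl⟩ := (mem_D9_iff ω v).1 hv
    choose p hp using fun i => ofCoords_surjective hω (g i)
    simp only [← hp] at hne ⊢
    rcases four_le_hammingNorm_codeword (p 0) (p 1) (p 2) (p 3) (p 4) with
      ⟨h0, h1, h2, h3, h4⟩ | h
    · simp [h0, h1, h2, h3, h4] at hne
    · rw [ofCoords_codeword hω, wt_ofCoords]
      exact h
  · refine ⟨fun i => ofCoords ω (codeword 0 0 (true, false) 0 0 i), ?_, ?_⟩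
    · rw [← ofCoords_codeword hω]
      exact (mem_D9_iff ω _).2 ⟨fun i => ofCoords ω (![0, 0, (true, false), 0, 0] i), by simp⟩
    · rw [wt_ofCoords]
      decide +kernel
end
end

section
/- The binary code C_E^36 is an optimal [36,19,8] linear code: the 19 listed generating vectors are linearly independent over GF(2) (so C_E^36 has dimension 19 as a GF(2)-subspace of GF(2)^36), every nonzero element of C_E^36 has Hamming weight at least 8, and some element has Hamming weight exactly 8. -/
open Matrix
open scoped Classical

noncomputable section

/-- φ : GF(4) → GF(2)⁴ with φ(0)=0000, φ(1)=0011, φ(ω)=0101, φ(ω̄)=0110. -/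
def phi (ω : F4) (x : F4) : Fin 4 → F2 :=
  if x = 0 then ![0, 0, 0, 0]
  else if x = 1 then ![0, 0, 1, 1]
  else if x = ω then ![0, 1, 0, 1]
  else ![0, 1, 1, 0]

/-- Φ applies φ to each coordinate and concatenates. -/
def Phi (ω : F4) (v : Fin 9 → F4) : Fin 36 → F2 := fun j =>
  phi ω (v ⟨j.val / 4, by have := j.isLt; omega⟩) ⟨j.val % 4, by omega⟩

/-- u i (for i = 0, …, 7, corresponding to u_(i+1)) has ones exactly in the eight
positions 4(i+1)-3, …, 4(i+1)+4 (1-indexed). -/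
def u (i : Fin 8) : Fin 36 → F2 := fun j =>
  if 4 * i.val ≤ j.val ∧ j.val < 4 * i.val + 8 then 1 else 0

/-- (1,0,0,0) repeated 9 times. -/
def d1 : Fin 36 → F2 := fun j => if j.val % 4 = 0 then 1 else 0

/-- (1,0,0,0) repeated 8 times followed by (0,1,1,1). -/
def d2 : Fin 36 → F2 := fun j =>
  if j.val < 32 then (if j.val % 4 = 0 then 1 else 0)
  else (if j.val % 4 = 0 then 0 else 1)

def gensE36 (ω : F4) : Fin 19 → Fin 36 → F2 :=
  ![Phi ω (r1 ω), Phi ω (r2 ω), Phi ω (r3 ω), Phi ω (r4 ω), Phi ω (r5 ω),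
    Phi ω (r6 ω), Phi ω (r7 ω), Phi ω (r8 ω), Phi ω (r9 ω), Phi ω (r10 ω),
    u 0, u 1, u 2, u 3, u 4, u 5, u 6, u 7, d2]

def CE36 (ω : F4) : Submodule F2 (Fin 36 → F2) :=
  Submodule.span F2 (Set.range (gensE36 ω))

/-- The coefficients of `1` in the coordinates of `r1, …, r10` with respect to the basis `1, ω`. -/
def oneCoeff : Matrix (Fin 10) (Fin 9) F2 :=
  !![1, 0, 0, 0, 0, 1, 1, 1, 1;
     0, 0, 0, 0, 0, 1, 0, 0, 0;
     0, 1, 0, 0, 0, 1, 0, 1, 0;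
     0, 0, 0, 0, 0, 0, 1, 1, 0;
     0, 0, 1, 0, 0, 0, 1, 0, 1;
     0, 0, 0, 0, 0, 0, 0, 1, 1;
     0, 0, 0, 1, 0, 1, 1, 0, 1;
     0, 0, 0, 0, 0, 1, 1, 0, 0;
     0, 0, 0, 0, 1, 1, 0, 1, 1;
     0, 0, 0, 0, 0, 0, 1, 0, 0]

/-- The coefficients of `ω` in the coordinates of `r1, …, r10` with respect to the basis `1, ω`. -/
def omegaCoeff : Matrix (Fin 10) (Fin 9) F2 :=
  !![0, 0, 0, 0, 0, 1, 0, 0, 0;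
     1, 0, 0, 0, 0, 0, 1, 1, 1;
     0, 0, 0, 0, 0, 0, 1, 1, 0;
     0, 1, 0, 0, 0, 1, 1, 0, 0;
     0, 0, 0, 0, 0, 0, 0, 1, 1;
     0, 0, 1, 0, 0, 0, 1, 1, 0;
     0, 0, 0, 0, 0, 1, 1, 0, 0;
     0, 0, 0, 1, 0, 0, 0, 0, 1;
     0, 0, 0, 0, 0, 0, 1, 0, 0;
     0, 0, 0, 0, 1, 1, 1, 1, 1]

/-- The vectors `r1, …, r10` as a family. -/
def quaternaryGens (ω : F4) : Fin 10 → Fin 9 → F4 :=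
  ![r1 ω, r2 ω, r3 ω, r4 ω, r5 ω, r6 ω, r7 ω, r8 ω, r9 ω, r10 ω]

theorem quaternaryGens_eq (ω : F4) (i : Fin 10) (k : Fin 9) :
    quaternaryGens ω i k = oneCoeff i k • (1 : F4) + omegaCoeff i k • ω := by
  fin_cases i <;> fin_cases k <;>
    simp [quaternaryGens, oneCoeff, omegaCoeff, r1, r2, r3, r4, r5, r6, r7, r8, r9, r10, add_comm]

theorem phi_smul_add_smul {ω : F4} (hω : ω ^ 2 = ω + 1) (a b : F2) :
    phi ω (a • (1 : F4) + b • ω) = ![0, b, a, a + b] := by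
  have h0 : ω ≠ 0 := by rintro rfl; simp at hω
  have h1 : ω ≠ 1 := by rintro rfl; simp at hω
  have h2 : 1 + ω ≠ 0 := by
    intro h
    rw [add_comm, h] at hω
    exact h0 (by simpa using hω)
  have zero_or_one : ∀ x : F2, x = 0 ∨ x = 1 := by decide
  rcases zero_or_one a with rfl | rfl <;> rcases zero_or_one b with rfl | rfl <;>
    simp [phi, h0, h1, h2]
  decide

/-- The index in `Fin 36` of the `m`-th coordinate of the `k`-th block of length four. -/
def blockIdx (k : Fin 9) (m : Fin 4) : Fin 36 := finProdFinEquiv (k, m)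

theorem blockIdx_val (k : Fin 9) (m : Fin 4) : (blockIdx k m).val = m + 4 * k := rfl

theorem Phi_quaternaryGens {ω : F4} (hω : ω ^ 2 = ω + 1) (i : Fin 10) (k : Fin 9) (m : Fin 4) :
    Phi ω (quaternaryGens ω i) (blockIdx k m) =
      ![0, omegaCoeff i k, oneCoeff i k, oneCoeff i k + omegaCoeff i k] m := by
  have hk : (⟨(blockIdx k m).val / 4, by have := (blockIdx k m).isLt; omega⟩ : Fin 9) = k := by
    ext; simp only [blockIdx_val]; omega
  have hm : (⟨(blockIdx k m).val % 4, by omega⟩ : Fin 4) = m := by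
    ext; simp only [blockIdx_val]; omega
  rw [Phi, hk, hm, quaternaryGens_eq, phi_smul_add_smul hω]

/-- The Hamming weight of a single bit. -/
def bitWt (a : F2) : ℕ := if a = 0 then 0 else 1

/-- The Hamming weight of the symbol `a + b ω`. -/
def symbolWt (a b : F2) : ℕ := if a = 0 ∧ b = 0 then 0 else 1

theorem bitWt_eq_zero {a : F2} : bitWt a = 0 ↔ a = 0 := by simp [bitWt]

theorem symbolWt_eq_zero {a b : F2} : symbolWt a b = 0 ↔ a = 0 ∧ b = 0 := by simp [symbolWt]

theorem wt_eq_sum_bitWt (v : Fin 36 → F2) :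
    wt v = ∑ k : Fin 9, ∑ m : Fin 4, bitWt (v (blockIdx k m)) := by
  rw [wt, Nat.card_eq_fintype_card, Fintype.card_subtype, Finset.card_filter,
    ← Fintype.sum_prod_type', ← Equiv.sum_comp (finProdFinEquiv (m := 9) (n := 4))]
  simp only [ne_eq, ite_not, bitWt, blockIdx, Prod.mk.eta]

/-- The repetition part of the `k`-th block: the coefficients of the `u i` covering that block. -/
def blockShift (t : Fin 8 → F2) (k : Fin 9) : F2 :=
  ∑ i : Fin 8, if i.castSucc = k ∨ i.succ = k then t i else 0

theorem gens_comb_blockIdx {ω : F4} (hω : ω ^ 2 = ω + 1) (c : Fin 10 → F2) (t : Fin 8 → F2)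
    (e : F2) (k : Fin 9) (m : Fin 4) :
    (∑ i, c i • Phi ω (quaternaryGens ω i) + ∑ i, t i • u i + e • d2) (blockIdx k m) =
      ![0, (c ᵥ* omegaCoeff) k, (c ᵥ* oneCoeff) k,
        (c ᵥ* oneCoeff) k + (c ᵥ* omegaCoeff) k] m + blockShift t k + e * d2 (blockIdx k m) := by
  simp only [Pi.add_apply, Finset.sum_apply, Pi.smul_apply, smul_eq_mul, Phi_quaternaryGens hω]
  congr 2
  · fin_cases m <;> simp [Matrix.vecMul, dotProduct, mul_add, Finset.sum_add_distrib]
  · refine Finset.sum_congr rfl fun i _ => ?_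
    have : (4 * i.val ≤ (blockIdx k m).val ∧ (blockIdx k m).val < 4 * i.val + 8) ↔
        (i.castSucc = k ∨ i.succ = k) := by
      simp only [blockIdx_val, Fin.ext_iff, Fin.val_castSucc, Fin.val_succ]
      omega
    simp [u, this]

theorem two_mul_symbolWt_le (a b s : F2) :
    2 * symbolWt a b ≤ ∑ m : Fin 4, bitWt (![0, b, a, a + b] m + s) := by
  revert a b s
  decide

theorem sum_bitWt_zero_add (s : F2) :
    ∑ m : Fin 4, bitWt (![0, 0, 0, 0 + 0] m + s) = 4 * bitWt s := by
  revert s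
  decide

theorem one_le_sum_bitWt_add_d2 (a b s : F2) (k : Fin 9) :
    1 ≤ ∑ m : Fin 4, bitWt (![0, b, a, a + b] m + s + 1 * d2 (blockIdx k m)) := by
  revert a b s k
  decide +kernel

theorem four_le_sum_symbolWt_explicit : ∀ x0 x1 x2 x3 x4 x5 x6 x7 x8 x9 : F2,
    symbolWt x0 x1 + symbolWt x2 x3 + symbolWt x4 x5 + symbolWt x6 x7 + symbolWt x8 x9 = 0 ∨
      4 ≤ symbolWt x0 x1 + symbolWt x2 x3 + symbolWt x4 x5 + symbolWt x6 x7 + symbolWt x8 x9 +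
        symbolWt (x0 + x1 + x2 + x6 + x7 + x8) (x0 + x3 + x6 + x9) +
        symbolWt (x0 + x3 + x4 + x6 + x7 + x9) (x1 + x2 + x3 + x5 + x6 + x8 + x9) +
        symbolWt (x0 + x2 + x3 + x5 + x8) (x1 + x2 + x4 + x5 + x9) +
        symbolWt (x0 + x4 + x5 + x6 + x8) (x1 + x4 + x7 + x9) := by
  decide +kernel

/-- The quaternary code spanned by `r1, …, r10` has minimum weight at least four. -/
theorem four_le_sum_symbolWt {c : Fin 10 → F2} (hc : c ≠ 0) :
    4 ≤ ∑ k, symbolWt ((c ᵥ* oneCoeff) k) ((c ᵥ* omegaCoeff) k) := by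
  rcases four_le_sum_symbolWt_explicit (c 0) (c 1) (c 2) (c 3) (c 4) (c 5) (c 6) (c 7) (c 8) (c 9) with h | h
  · simp only [Nat.add_eq_zero_iff, symbolWt_eq_zero] at h
    exact absurd (funext fun i => by fin_cases i <;> simp [h]) hc
  · simpa [Matrix.vecMul, dotProduct, oneCoeff, omegaCoeff, Fin.sum_univ_succ, add_assoc] using h

theorem two_le_sum_bitWt_explicit : ∀ t0 t1 t2 t3 t4 t5 t6 t7 : F2,
    bitWt t0 + bitWt t1 + bitWt t2 + bitWt t3 + bitWt t4 + bitWt t5 + bitWt t6 + bitWt t7 = 0 ∨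
      2 ≤ bitWt t0 + bitWt (t0 + t1) + bitWt (t1 + t2) + bitWt (t2 + t3) + bitWt (t3 + t4) +
        bitWt (t4 + t5) + bitWt (t5 + t6) + bitWt (t6 + t7) + bitWt t7 := by
  decide +kernel

theorem two_le_sum_bitWt_blockShift {t : Fin 8 → F2} (ht : t ≠ 0) :
    2 ≤ ∑ k, bitWt (blockShift t k) := by
  rcases two_le_sum_bitWt_explicit (t 0) (t 1) (t 2) (t 3) (t 4) (t 5) (t 6) (t 7) with h | h
  · simp only [Nat.add_eq_zero_iff, bitWt_eq_zero] at h
    exact absurd (funext fun i => by fin_cases i <;> simp [h]) ht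
  · simpa [Fin.sum_univ_succ, blockShift, add_assoc] using h

theorem eight_le_wt_comb {ω : F4} (hω : ω ^ 2 = ω + 1) (c : Fin 10 → F2) (t : Fin 8 → F2)
    (e : F2) (h : c ≠ 0 ∨ t ≠ 0 ∨ e ≠ 0) :
    8 ≤ wt (∑ i, c i • Phi ω (quaternaryGens ω i) + ∑ i, t i • u i + e • d2) := by
  simp only [wt_eq_sum_bitWt, gens_comb_blockIdx hω]
  by_cases he : e = 0
  · subst he
    simp only [zero_mul, add_zero]
    by_cases hc : c = 0
    · subst hc
      have ht : t ≠ 0 := by simpa using h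
      simp only [Matrix.zero_vecMul, Pi.zero_apply, sum_bitWt_zero_add, ← Finset.mul_sum]
      have := two_le_sum_bitWt_blockShift ht
      omega
    · calc 8 ≤ 2 * ∑ k, symbolWt ((c ᵥ* oneCoeff) k) ((c ᵥ* omegaCoeff) k) := by
            have := four_le_sum_symbolWt hc
            omega
        _ ≤ _ := by
            rw [Finset.mul_sum]
            exact Finset.sum_le_sum fun k _ => two_mul_symbolWt_le _ _ _
  · obtain rfl : e = 1 := Fin.eq_one_of_ne_zero e he
    calc 8 ≤ ∑ _k : Fin 9, 1 := by simp
      _ ≤ _ := Finset.sum_le_sum fun k _ => one_le_sum_bitWt_add_d2 _ _ _ k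

theorem sum_gensE36 (ω : F4) (x : Fin 19 → F2) :
    ∑ i, x i • gensE36 ω i =
      ∑ i : Fin 10, x (Fin.castAdd 9 i) • Phi ω (quaternaryGens ω i) +
        ∑ i : Fin 8, x (Fin.natAdd 10 i.castSucc) • u i + x (Fin.last 18) • d2 := by
  refine (Fin.sum_univ_add (a := 10) (b := 9) fun i => x i • gensE36 ω i).trans ?_
  rw [Fin.sum_univ_castSucc (n := 8), ← add_assoc]
  congr 2

theorem eight_le_wt_sum_gensE36 {ω : F4} (hω : ω ^ 2 = ω + 1) {x : Fin 19 → F2} (hx : x ≠ 0) :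
    8 ≤ wt (∑ i, x i • gensE36 ω i) := by
  rw [sum_gensE36]
  apply eight_le_wt_comb hω
  contrapose! hx
  obtain ⟨hc, ht, he⟩ := hx
  funext i
  induction i using Fin.addCases (m := 10) (n := 9) with
  | left i => exact congrFun hc i
  | right i =>
    induction i using Fin.lastCases with
    | last => exact he
    | cast i => exact congrFun ht i

theorem wt_zero : wt (0 : Fin 36 → F2) = 0 := by simp [wt]

theorem wt_u_zero : wt (u 0) = 8 := by
  rw [wt_eq_sum_bitWt]
  decide +kernel

theorem stmt9 (ω : F4) (hω : ω ^ 2 = ω + 1) :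
    LinearIndependent F2 (gensE36 ω) ∧
    Module.finrank F2 (CE36 ω) = 19 ∧
    (∀ v ∈ CE36 ω, v ≠ 0 → 8 ≤ wt v) ∧ (∃ v ∈ CE36 ω, wt v = 8) := by
  have hli : LinearIndependent F2 (gensE36 ω) := by
    refine Fintype.linearIndependent_iff.2 fun x hx => ?_
    by_contra! hne
    have h := eight_le_wt_sum_gensE36 hω (x := x) fun h => hne.elim fun i hi => hi (congrFun h i)
    rw [hx, wt_zero] at h
    omega
  refine ⟨hli, ?_, ?_, u 0, Submodule.subset_span ⟨10, rfl⟩, wt_u_zero⟩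
  · exact (finrank_span_eq_card hli).trans (Fintype.card_fin 19)
  · rintro v hv hv0
    obtain ⟨x, rfl⟩ := (Submodule.mem_span_range_iff_exists_fun F2).1 hv
    exact eight_le_wt_sum_gensE36 hω fun h => hv0 (by simp [h])
end
end

section
/- The weight distribution of C_E^36 is: the number of codewords of Hamming weight w equals 1 for w=0, 444 for w=8, 528 for w=9, 2160 for w=10, 4464 for w=11, 8760 for w=12, 19008 for w=13, 28992 for w=14, 41664 for w=15, 54318 for w=16, 66528 for w=17, 72864 for w=18, 62496 for w=19, 54192 for w=20, 44352 for w=21, 28992 for w=22, 17856 for w=23, 8844 for w=24, 4752 for w=25, 2160 for w=26, 496 for w=27, 408 for w=28, 9 for w=32, and 0 for all other w. -/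
open Matrix
open scoped Classical

noncomputable section

/-- The binary word whose coordinates are the low bits of `n`. -/
def word {k : ℕ} (n : ℕ) : Fin k → F2 := fun j => if n.testBit j then 1 else 0

theorem word_xor {k : ℕ} (a b : ℕ) : (word (a ^^^ b) : Fin k → F2) = word a + word b := by
  funext j
  simp only [word, Nat.testBit_xor, Pi.add_apply]
  cases a.testBit j <;> cases b.testBit j <;> decide

/-- The sum of `f` over all xors of `x` with a sublist of `l`. -/
def xorSum (f : ℕ → ℕ) : List ℕ → ℕ → ℕ
  | [], x => f x
  | g :: l, x => xorSum f l x + xorSum f l (x ^^^ g)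

theorem xorSum_append (f : ℕ → ℕ) (l l' : List ℕ) (x : ℕ) :
    xorSum f (l ++ l') x = xorSum (xorSum f l') l x := by
  induction l generalizing x with
  | nil => rfl
  | cons g l ih => simp only [List.cons_append, xorSum, ih]

theorem xorSum_concat (f : ℕ → ℕ) (l : List ℕ) (d x : ℕ) :
    xorSum f (l ++ [d]) x = xorSum f l x + xorSum f l (x ^^^ d) := by
  induction l generalizing x with
  | nil => rfl
  | cons g l ih =>
    simp only [List.cons_append, xorSum, ih]
    rw [Nat.xor_right_comm x g d, add_add_add_comm]

theorem sum_linearCombination_word {k n : ℕ} (F : (Fin k → F2) → ℕ) (g : Fin n → ℕ) (x : ℕ) :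
    ∑ m : Fin n → F2, F (word x + ∑ i, m i • word (g i)) =
      xorSum (fun y => F (word y)) (List.ofFn g) x := by
  induction n generalizing x with
  | zero => simp [xorSum]
  | succ n ih =>
    rw [← (Fin.consEquiv (fun _ => F2)).sum_comp, Fintype.sum_prod_type]
    have h2 : ∀ h : F2 → ℕ, ∑ b : F2, h b = h 0 + h 1 := Fin.sum_univ_two
    rw [h2, List.ofFn_succ, xorSum, ← ih, ← ih]
    simp [Fin.consEquiv, Fin.sum_univ_succ, word_xor, add_assoc]

/-- The number of ones among the four low bits of `y`. -/
def nibbleWeight (y : ℕ) : ℕ := y % 2 + y / 2 % 2 + y / 4 % 2 + y / 8 % 2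

/-- The number of ones among the `4 * (n + 1)` low bits of `x`. -/
def lowWeight : ℕ → ℕ → ℕ
  | 0, x => nibbleWeight (x % 16)
  | n + 1, x => nibbleWeight (x % 16) + lowWeight n (x / 16)

theorem wt_word (n : ℕ) : wt (word n : Fin 36 → F2) = lowWeight 8 n := by
  have h : ∀ j : ℕ, (if (if n.testBit j then (1 : F2) else 0) ≠ 0 then 1 else 0) =
      n / 2 ^ j % 2 := by
    intro j
    rw [Nat.testBit_eq_decide_div_mod_eq]
    rcases Nat.mod_two_eq_zero_or_one (n / 2 ^ j) with h | h <;> simp [h]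
  have hsum : wt (word n : Fin 36 → F2) = ∑ j : Fin 36, n / 2 ^ (j : ℕ) % 2 := by
    rw [wt, Nat.card_eq_fintype_card, Fintype.card_subtype, Finset.card_filter]
    exact Finset.sum_congr rfl fun j _ => (by congr : _ = _).trans (h j)
  rw [hsum, Fin.sum_univ_eq_sum_range (fun j => n / 2 ^ j % 2)]
  have hn : ∀ y : ℕ, nibbleWeight (y % 16) = y % 2 + y / 2 % 2 + y / 4 % 2 + y / 8 % 2 :=
    fun y => by unfold nibbleWeight; omega
  simp only [Finset.sum_range_succ, Finset.sum_range_zero, lowWeight, hn,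
    Nat.div_div_eq_div_mul]
  norm_num
  ring

/-- Masks `255 * 16 ^ i`, `i < n`, with ones in two consecutive nibbles. -/
def pairMasks : ℕ → List ℕ
  | 0 => []
  | n + 1 => 255 :: (pairMasks n).map (16 * ·)

theorem xorSum_map_sixteen (c g : ℕ → ℕ) (l : List ℕ) (x : ℕ) :
    xorSum (fun y => c (y % 16) * g (y / 16)) (l.map (16 * ·)) x =
      c (x % 16) * xorSum g l (x / 16) := by
  induction l generalizing x with
  | nil => rfl
  | cons a l ih =>
    have h1 : (x ^^^ 16 * a) % 16 = x % 16 := by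
      have := @Nat.xor_mod_two_pow x (16 * a) 4
      simpa using this
    have h2 : (x ^^^ 16 * a) / 16 = x / 16 ^^^ a := by
      have := @Nat.xor_div_two_pow x (16 * a) 4
      simpa using this
    simp only [List.map_cons, xorSum, ih, h1, h2, mul_add]

/-- The monomial `B ^ weight` of a nibble, with `B = 2 ^ 20`. -/
def nibbleTerm (y : ℕ) : ℕ := (2 ^ 20) ^ nibbleWeight y

/-- Transfer-matrix evaluation of the weight enumerators, at `2 ^ 20`, of the cosets of
`x` and `x ^^^ 15` modulo `pairMasks n`. -/
def transfer : ℕ → ℕ → ℕ × ℕ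
  | 0, x => (nibbleTerm (x % 16), nibbleTerm (x % 16 ^^^ 15))
  | n + 1, x =>
    match transfer n (x / 16) with
    | (s, t) => (nibbleTerm (x % 16) * s + nibbleTerm (x % 16 ^^^ 15) * t,
        nibbleTerm (x % 16 ^^^ 15) * s + nibbleTerm (x % 16) * t)

theorem transfer_eq (n x : ℕ) :
    transfer n x = (xorSum (fun y => (2 ^ 20) ^ lowWeight n y) (pairMasks n) x,
      xorSum (fun y => (2 ^ 20) ^ lowWeight n y) (pairMasks n) (x ^^^ 15)) := by
  have mod15 : ∀ x : ℕ, (x ^^^ 15) % 16 = x % 16 ^^^ 15 := fun x => @Nat.xor_mod_two_pow x 15 4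
  have div15 : ∀ x : ℕ, (x ^^^ 15) / 16 = x / 16 := fun x => by
    simpa using @Nat.xor_div_two_pow x 15 4
  have mod255 : ∀ x : ℕ, (x ^^^ 255) % 16 = x % 16 ^^^ 15 :=
    fun x => @Nat.xor_mod_two_pow x 255 4
  have div255 : ∀ x : ℕ, (x ^^^ 255) / 16 = x / 16 ^^^ 15 :=
    fun x => @Nat.xor_div_two_pow x 255 4
  have cancel : ∀ y : ℕ, y ^^^ 15 ^^^ 15 = y := fun y => by simp
  induction n generalizing x with
  | zero => simp only [transfer, pairMasks, xorSum, lowWeight, nibbleTerm, mod15]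
  | succ n ih =>
    have key : ∀ z : ℕ, xorSum (fun y => (2 ^ 20) ^ lowWeight (n + 1) y)
        ((pairMasks n).map (16 * ·)) z =
        nibbleTerm (z % 16) * xorSum (fun y => (2 ^ 20) ^ lowWeight n y) (pairMasks n) (z / 16) :=
      fun z => by
        rw [← xorSum_map_sixteen]
        simp only [lowWeight, pow_add, nibbleTerm]
    simp only [transfer, pairMasks, xorSum, ih, key, mod15, div15, mod255, div255, cancel]

/-- The bit masks of the images under `Φ` of the generators of `C_4^9`. -/
def quaternaryMasks : List ℕ :=
  [54968451084, 45814382602, 1790968000, 3332374688, 28655488000, 53317995008, 51646611456,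
    43163623424, 54941974528, 45745831936]

/-- The bit masks of the generators of `C_E^36`. -/
def masks : Fin 19 → ℕ :=
  ![54968451084, 45814382602, 1790968000, 3332374688, 28655488000, 53317995008, 51646611456,
    43163623424, 54941974528, 45745831936, 255, 4080, 65280, 1044480, 16711680, 267386880,
    4278190080, 68451041280, 60415873297]

theorem ofFn_masks : List.ofFn masks = quaternaryMasks ++ (pairMasks 8 ++ [60415873297]) := by
  simp [List.ofFn_succ, masks, quaternaryMasks, pairMasks]

/-- The claimed weight distribution. -/
def weightCount (w : ℕ) : ℕ :=
  if w = 0 then 1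
  else if w = 8 then 444
  else if w = 9 then 528
  else if w = 10 then 2160
  else if w = 11 then 4464
  else if w = 12 then 8760
  else if w = 13 then 19008
  else if w = 14 then 28992
  else if w = 15 then 41664
  else if w = 16 then 54318
  else if w = 17 then 66528
  else if w = 18 then 72864
  else if w = 19 then 62496
  else if w = 20 then 54192
  else if w = 21 then 44352
  else if w = 22 then 28992
  else if w = 23 then 17856
  else if w = 24 then 8844
  else if w = 25 then 4752
  else if w = 26 then 2160
  else if w = 27 then 496
  else if w = 28 then 408
  else if w = 32 then 9 else 0

theorem weightCount_eq_zero {w : ℕ} (hw : 37 ≤ w) : weightCount w = 0 := by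
  have h : ∀ k < 37, w ≠ k := fun k hk => by omega
  unfold weightCount
  iterate 23 rw [if_neg (h _ (by norm_num))]

theorem weightCount_lt (w : ℕ) : weightCount w < 2 ^ 20 := by
  have h : ∀ w < 37, weightCount w < 2 ^ 20 := by decide +kernel
  rcases lt_or_ge w 37 with hw | hw
  · exact h w hw
  · rw [weightCount_eq_zero hw]
    norm_num

theorem xorSum_masks :
    xorSum (fun y => (2 ^ 20) ^ lowWeight 8 y) (List.ofFn masks) 0 =
      ∑ w ∈ Finset.range 37, weightCount w * (2 ^ 20) ^ w := by
  have h : (fun x => xorSum (fun y => (2 ^ 20) ^ lowWeight 8 y) (pairMasks 8 ++ [60415873297]) x) =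
      fun x => (transfer 8 x).1 + (transfer 8 (x ^^^ 60415873297)).1 := by
    funext x
    rw [xorSum_concat, transfer_eq, transfer_eq]
  rw [ofFn_masks, xorSum_append]
  change xorSum (fun x => xorSum _ _ x) _ _ = _
  rw [h]
  decide +kernel

theorem eq_of_sum_mul_pow_eq {B n : ℕ} {f g : ℕ → ℕ} (hf : ∀ i, f i < B) (hg : ∀ i, g i < B)
    (h : ∑ i ∈ Finset.range n, f i * B ^ i = ∑ i ∈ Finset.range n, g i * B ^ i) :
    ∀ i < n, f i = g i := by
  induction n generalizing f g with
  | zero => simp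
  | succ n ih =>
    have step : ∀ f : ℕ → ℕ, ∑ i ∈ Finset.range (n + 1), f i * B ^ i =
        f 0 + B * ∑ i ∈ Finset.range n, f (i + 1) * B ^ i := fun f => by
      rw [Finset.sum_range_succ', Finset.mul_sum, add_comm]
      simp only [pow_zero, mul_one, pow_succ]
      congr 1
      exact Finset.sum_congr rfl fun i _ => by ring
    rw [step, step] at h
    have h0 : f 0 = g 0 := by
      have := congrArg (· % B) h
      simpa [Nat.mod_eq_of_lt (hf 0), Nat.mod_eq_of_lt (hg 0)] using this
    have hB : 0 < B := (Nat.zero_le _).trans_lt (hf 0)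
    have h1 := ih (fun i => hf (i + 1)) (fun i => hg (i + 1))
      (Nat.eq_of_mul_eq_mul_left hB (by omega))
    rintro (_ | i) hi
    · exact h0
    · exact h1 i (by omega)

theorem Phi_eq_word {ω : F4} {v : Fin 9 → F4} {n : ℕ}
    (h : ∀ i : Fin 9, phi ω (v i) = word (n / 2 ^ (4 * (i : ℕ)))) : Phi ω v = word n := by
  funext j
  simp only [Phi, h, word, Nat.testBit_div_two_pow, Nat.mod_add_div]

theorem gensE36_eq_word {ω : F4} (hω : ω ^ 2 = ω + 1) (i : Fin 19) :
    gensE36 ω i = word (masks i) := by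
  have h0 : ω ≠ 0 := by rintro rfl; simp at hω
  have h1 : ω ≠ 1 := by rintro rfl; simp at hω
  have h2 : ω + 1 ≠ 0 := by rw [← hω]; exact pow_ne_zero 2 h0
  have h3 : ω + 1 ≠ 1 := by simpa using h0
  have h4 : ω + 1 ≠ ω := by simp
  have p0 : phi ω 0 = ![0, 0, 0, 0] := by simp [phi]
  have p1 : phi ω 1 = ![0, 0, 1, 1] := by simp [phi]
  have p2 : phi ω ω = ![0, 1, 0, 1] := by simp [phi, h0, h1]
  have p3 : phi ω (ω + 1) = ![0, 1, 1, 0] := by simp only [phi, h2, h3, h4, if_false]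
  have hu : ∀ i : Fin 8, u i = word (255 * 16 ^ (i : ℕ)) := by decide
  have hd : d2 = word 60415873297 := by decide
  fin_cases i
  iterate 10
    · refine Phi_eq_word fun i => ?_
      fin_cases i <;>
      first
        | exact p0.trans (by decide)
        | exact p1.trans (by decide)
        | exact p2.trans (by decide)
        | exact p3.trans (by decide)
  · exact hu 0
  · exact hu 1
  · exact hu 2
  · exact hu 3
  · exact hu 4
  · exact hu 5
  · exact hu 6
  · exact hu 7
  · exact hd

theorem wt_le {n : ℕ} (v : Fin n → F2) : wt v ≤ n := by
  rw [wt, Nat.card_eq_fintype_card]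
  exact (Fintype.card_subtype_le _).trans_eq (Fintype.card_fin n)

theorem card_messages_weight {ω : F4} (hω : ω ^ 2 = ω + 1) (w : ℕ) :
    (Finset.univ.filter fun m : Fin 19 → F2 =>
      wt (Fintype.linearCombination F2 (gensE36 ω) m) = w).card = weightCount w := by
  set L := Fintype.linearCombination F2 (gensE36 ω) with hL
  set N : ℕ → ℕ := fun w => (Finset.univ.filter fun m : Fin 19 → F2 => wt (L m) = w).card with hN
  change N w = _
  have hbound : ∀ w, N w < 2 ^ 20 := fun w =>
    (Finset.card_le_univ _).trans_lt (by
      rw [Fintype.card_fun, ZMod.card, Fintype.card_fin]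
      norm_num)
  have hsum : ∑ m : Fin 19 → F2, (2 ^ 20) ^ wt (L m) =
      ∑ w ∈ Finset.range 37, N w * (2 ^ 20) ^ w := by
    rw [← Finset.sum_fiberwise_of_maps_to (t := Finset.range 37) (g := fun m => wt (L m))
      (fun m _ => Finset.mem_range.mpr (Nat.lt_succ_of_le (wt_le _)))]
    refine Finset.sum_congr rfl fun w _ => ?_
    rw [Finset.sum_congr rfl (g := fun _ => (2 ^ 20) ^ w)
      (fun m hm => by rw [(Finset.mem_filter.mp hm).2]), Finset.sum_const, smul_eq_mul]
  have hword : ∀ m, L m = word 0 + ∑ i, m i • word (masks i) := fun m => by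
    have : (word 0 : Fin 36 → F2) = 0 := by funext j; simp [word]
    simp only [hL, Fintype.linearCombination_apply, gensE36_eq_word hω, this, zero_add]
  have htotal : ∑ m : Fin 19 → F2, (2 ^ 20) ^ wt (L m) =
      ∑ w ∈ Finset.range 37, weightCount w * (2 ^ 20) ^ w := by
    rw [← xorSum_masks]
    simp only [hword, ← wt_word]
    exact sum_linearCombination_word (fun v => (2 ^ 20) ^ wt v) masks 0
  by_cases hw : w < 37
  · exact eq_of_sum_mul_pow_eq hbound weightCount_lt (hsum.symm.trans htotal) w hw
  · have h0 : N w = 0 := by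
      rw [hN, Finset.card_eq_zero, Finset.filter_eq_empty_iff]
      rintro m - rfl
      exact hw (Nat.lt_succ_of_le (wt_le _))
    rw [h0, weightCount_eq_zero (not_lt.mp hw)]

theorem linearCombination_gensE36_injective {ω : F4} (hω : ω ^ 2 = ω + 1) :
    Function.Injective (Fintype.linearCombination F2 (gensE36 ω)) := by
  have h := card_messages_weight hω 0
  obtain ⟨a, ha⟩ := Finset.card_eq_one.mp h
  have key : ∀ m, Fintype.linearCombination F2 (gensE36 ω) m = 0 → m = a := fun m hm =>
    Finset.mem_singleton.mp (ha ▸ Finset.mem_filter.mpr ⟨Finset.mem_univ m, by simp [hm, wt]⟩)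
  refine (injective_iff_map_eq_zero _).mpr fun m hm => ?_
  rw [key m hm, key 0 (map_zero _)]

theorem stmt15 (ω : F4) (hω : ω ^ 2 = ω + 1) (w : ℕ) :
    Set.ncard {v | v ∈ CE36 ω ∧ wt v = w} =
      if w = 0 then 1 else if w = 8 then 444 else if w = 9 then 528 else if w = 10 then 2160 else if w = 11 then 4464 else if w = 12 then 8760 else if w = 13 then 19008 else if w = 14 then 28992 else if w = 15 then 41664 else if w = 16 then 54318 else if w = 17 then 66528 else if w = 18 then 72864 else if w = 19 then 62496 else if w = 20 then 54192 else if w = 21 then 44352 else if w = 22 then 28992 else if w = 23 then 17856 else if w = 24 then 8844 else if w = 25 then 4752 else if w = 26 then 2160 else if w = 27 then 496 else if w = 28 then 408 else if w = 32 then 9 else 0 := by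
  change _ = weightCount w
  rw [← card_messages_weight hω w, ← Set.ncard_coe_finset,
    ← Set.ncard_image_of_injective _ (linearCombination_gensE36_injective hω)]
  congr 1
  ext v
  simp only [CE36, ← Fintype.range_linearCombination, LinearMap.mem_range, Set.mem_ofPred_eq,
    Set.mem_image, Finset.coe_filter, Finset.mem_univ, true_and]
  constructor
  · rintro ⟨⟨m, rfl⟩, hw⟩
    exact ⟨m, hw, rfl⟩
  · rintro ⟨m, hw, rfl⟩
    exact ⟨⟨m, rfl⟩, hw⟩
end
end
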